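/- Let ρ = Σ_i r_i ≥ 2, assume the edge-switch chain on Ω = Ω(r,c,F) is irreducible, and set δ = 2·C(ρ,2)/(n²·C(m,2)); assume δ ≤ 1. Then (1 − λ_*^c)^{-1} ≤ (1/δ)·(1 − λ_*^{edge})^{-1}, where λ_*^c and λ_*^{edge} are the second-largest eigenvalues of the Curveball transition matrix P_c and the edge-switch transition matrix P_edge respectively. In particular, 1/δ is polynomial in n, m, ρ, so the Curveball chain is rapidly mixing whenever the edge-switch chain is rapidly mixing. -/

import Mathlib

open Finset

attribute [local instance] Classical.propDecidable

/-- A binary `m × n` matrix, with `true` representing a `1` entry. -/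
abbrev BinMat (m n : ℕ) := Fin m → Fin n → Bool

/-- `A ∈ Ω(r,c,F)`: the binary matrix `A` has row sums `r`, column sums `c`, and is zero
on the forbidden entries `F`. -/
def inOmega {m n : ℕ} (r : Fin m → ℕ) (c : Fin n → ℕ) (F : Finset (Fin m × Fin n))
    (A : BinMat m n) : Prop :=
  (∀ i : Fin m, (univ.filter fun k => A i k = true).card = r i) ∧
  (∀ k : Fin n, (univ.filter fun i => A i k = true).card = c k) ∧
  ∀ p ∈ F, A p.1 p.2 = false

/-- `U_ij(A)`: columns with a `1` in row `i`, a `0` in row `j`, and `(j,k)` not forbidden. -/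
def Uset {m n : ℕ} (F : Finset (Fin m × Fin n)) (i j : Fin m) (A : BinMat m n) :
    Finset (Fin n) :=
  univ.filter fun k => A i k = true ∧ A j k = false ∧ (j, k) ∉ F

/-- `L_ij(A)`: columns with a `0` in row `i`, a `1` in row `j`, and `(i,k)` not forbidden. -/
def Lset {m n : ℕ} (F : Finset (Fin m × Fin n)) (i j : Fin m) (A : BinMat m n) :
    Finset (Fin n) :=
  univ.filter fun k => A i k = false ∧ A j k = true ∧ (i, k) ∉ F

/-- `u_ij(A) = |U_ij(A)|`. -/
def usize {m n : ℕ} (F : Finset (Fin m × Fin n)) (i j : Fin m) (A : BinMat m n) : ℕ :=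
  (Uset F i j A).card

/-- `l_ij(A) = |L_ij(A)|`. -/
def lsize {m n : ℕ} (F : Finset (Fin m × Fin n)) (i j : Fin m) (A : BinMat m n) : ℕ :=
  (Lset F i j A).card

/-- `B ∈ N_ij(A)`: `B ∈ Ω` and `B` agrees with `A` outside `{i,j} × (U_ij(A) ∪ L_ij(A))`. -/
def inNbhd {m n : ℕ} (r : Fin m → ℕ) (c : Fin n → ℕ) (F : Finset (Fin m × Fin n))
    (i j : Fin m) (A B : BinMat m n) : Prop :=
  inOmega r c F B ∧
  ∀ k l, (k, l) ∉ (({i, j} : Finset (Fin m)) ×ˢ (Uset F i j A ∪ Lset F i j A)) →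
    B k l = A k l

/-- `A` and `B` are switch-adjacent for rows `i, j`: `A - B` has exactly four nonzero
entries, all in rows `i` and `j`, and the columns containing them have no forbidden
entries in rows `i` and `j`. -/
def switchAdjIJ {m n : ℕ} (F : Finset (Fin m × Fin n)) (i j : Fin m)
    (A B : BinMat m n) : Prop :=
  ((univ : Finset (Fin m × Fin n)).filter fun p => A p.1 p.2 ≠ B p.1 p.2).card = 4 ∧
  (∀ p ∈ (univ : Finset (Fin m × Fin n)).filter fun p => A p.1 p.2 ≠ B p.1 p.2,
    p.1 = i ∨ p.1 = j) ∧
  ∀ p ∈ (univ : Finset (Fin m × Fin n)).filter fun p => A p.1 p.2 ≠ B p.1 p.2,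
    (i, p.2) ∉ F ∧ (j, p.2) ∉ F

/-- The pairs of rows `i < j`. -/
def rowPairs (m : ℕ) : Finset (Fin m × Fin m) :=
  univ.filter fun p => p.1 < p.2

/-- The state space `Ω(r,c,F)` as a type. -/
abbrev OmegaType {m n : ℕ} (r : Fin m → ℕ) (c : Fin n → ℕ) (F : Finset (Fin m × Fin n)) :=
  {A : BinMat m n // inOmega r c F A}

/-- Transition matrix of the Curveball chain on `Ω(r,c,F)`.  (For `A ≠ B` at most one
row pair `p` satisfies `B ∈ N_p(A)`, so the sum below has at most one nonzero term.) -/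
noncomputable def Pcurve {m n : ℕ} (r : Fin m → ℕ) (c : Fin n → ℕ)
    (F : Finset (Fin m × Fin n)) :
    Matrix (OmegaType r c F) (OmegaType r c F) ℝ :=
  Matrix.of fun A B =>
    if A = B then
      (m.choose 2 : ℝ)⁻¹ *
        ∑ p ∈ rowPairs m,
          (((usize F p.1 p.2 A.val + lsize F p.1 p.2 A.val).choose
            (usize F p.1 p.2 A.val) : ℝ))⁻¹
    else
      ∑ p ∈ rowPairs m,
        if inNbhd r c F p.1 p.2 A.val B.val then
          (m.choose 2 : ℝ)⁻¹ *
            (((usize F p.1 p.2 A.val + lsize F p.1 p.2 A.val).choose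
              (usize F p.1 p.2 A.val) : ℝ))⁻¹
        else 0

/-- Transition matrix of the edge-switch chain on `Ω(r,c,F)`, where `ρ` is the total
number of ones of each matrix in `Ω(r,c,F)`: each pair of distinct switch-adjacent
matrices has transition probability `C(ρ,2)⁻¹`. -/
noncomputable def Pedge {m n : ℕ} (r : Fin m → ℕ) (c : Fin n → ℕ)
    (F : Finset (Fin m × Fin n)) (ρ : ℕ) :
    Matrix (OmegaType r c F) (OmegaType r c F) ℝ :=
  Matrix.of fun A B =>
    if A = B then
      1 - ∑ _B' ∈ univ.filter (fun B' : OmegaType r c F =>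
            B' ≠ A ∧ ∃ p ∈ rowPairs m, switchAdjIJ F p.1 p.2 A.val B'.val),
          ((ρ.choose 2 : ℝ))⁻¹
    else if ∃ p ∈ rowPairs m, switchAdjIJ F p.1 p.2 A.val B.val then
      ((ρ.choose 2 : ℝ))⁻¹
    else 0


section helpers

open Matrix
theorem spec_aux {ι : Type*} [Fintype ι] [DecidableEq ι] (M : Matrix ι ι ℝ) (hM : M.IsHermitian)
    (lam : ℕ → ℝ) (hlam : Antitone lam)
    (hroots : M.charpoly.roots = (Multiset.range (Fintype.card ι)).map lam) :
    ∃ b : Fin (Fintype.card ι) → ι → ℝ, (∀ i j, b i ⬝ᵥ b j = if i = j then 1 else 0) ∧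
      (∀ i, M *ᵥ b i = lam i • b i) ∧
      ∀ x y : ι → ℝ, x ⬝ᵥ y = ∑ i, (b i ⬝ᵥ x) * (b i ⬝ᵥ y) := by
  have h1 := hM.roots_charpoly_eq_eigenvalues₀
  rw [hroots] at h1
  let e : Fin (Fintype.card ι) ≃ ι := Fintype.equivOfCardEq (Fintype.card_fin _)
  have he : ∀ i, hM.eigenvalues (e i) = hM.eigenvalues₀ i := by
    intro i
    simp [Matrix.IsHermitian.eigenvalues, e]
  have h2 : List.ofFn (fun i : Fin (Fintype.card ι) => lam i) = List.ofFn hM.eigenvalues₀ := by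
    have hp : List.Perm (List.ofFn (fun i : Fin (Fintype.card ι) => lam i))
        (List.ofFn hM.eigenvalues₀) := by
      rw [← Multiset.coe_eq_coe]
      have ha : (Multiset.range (Fintype.card ι)).map lam
          = ((List.ofFn (fun i : Fin (Fintype.card ι) => lam i) : List ℝ) : Multiset ℝ) := by
        rw [List.ofFn_eq_map, ← Multiset.coe_range, Multiset.map_coe, ← List.map_coe_finRange_eq_range, List.map_map]
        rfl
      rw [← ha, h1, Fin.univ_val_map]
      rfl
    refine List.Perm.eq_of_pairwise' (r := (· ≥ ·)) ?_ ?_ hp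
    · rw [List.pairwise_ofFn]
      intro i j hij
      exact hlam (by exact_mod_cast hij.le)
    · rw [List.pairwise_ofFn]
      intro i j hij
      exact hM.eigenvalues₀_antitone hij.le
  have hσ := List.ofFn_inj.1 h2
  have hip : ∀ x y : EuclideanSpace ℝ ι, inner ℝ x y = x.ofLp ⬝ᵥ y.ofLp := by
    intro x y
    simp [PiLp.inner_apply, dotProduct, mul_comm]
  refine ⟨fun i => (hM.eigenvectorBasis (e i)).ofLp, ?_, ?_, ?_⟩
  · intro i j
    rw [← hip, orthonormal_iff_ite.1 hM.eigenvectorBasis.orthonormal]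
    simp
  · intro i
    rw [hM.mulVec_eigenvectorBasis]
    rw [he, ← hσ]
  · intro x y
    have := hM.eigenvectorBasis.sum_inner_mul_inner (WithLp.toLp 2 x) (WithLp.toLp 2 y)
    simp only [hip] at this
    rw [← this, ← e.sum_comp]
    refine Finset.sum_congr rfl fun i _ => ?_
    simp [dotProduct_comm]

theorem quad_aux {ι : Type*} [Fintype ι] [DecidableEq ι] (M : Matrix ι ι ℝ) (hM : M.IsHermitian)
    {N : ℕ} (lam : ℕ → ℝ) (b : Fin N → ι → ℝ)
    (hb : ∀ i, M *ᵥ b i = lam i • b i)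
    (hp : ∀ x y : ι → ℝ, x ⬝ᵥ y = ∑ i, (b i ⬝ᵥ x) * (b i ⬝ᵥ y)) (x : ι → ℝ) :
    x ⬝ᵥ M *ᵥ x = ∑ i : Fin N, lam i * (b i ⬝ᵥ x) ^ 2 := by
  rw [hp]
  refine Finset.sum_congr rfl fun i _ => ?_
  have : b i ⬝ᵥ M *ᵥ x = lam i * (b i ⬝ᵥ x) := by
    rw [dotProduct_mulVec, ← mulVec_transpose]
    have ht : Mᵀ = M := by simpa [Matrix.IsHermitian] using hM
    rw [ht, hb]; simp
  rw [this]; ring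

theorem compare_aux {ι : Type*} [Fintype ι] [DecidableEq ι] (hc : 2 ≤ Fintype.card ι)
    (M K : Matrix ι ι ℝ) (hM : M.IsHermitian) (hK : K.IsHermitian)
    (lam mu : ℕ → ℝ) (hlam : Antitone lam) (hmu : Antitone mu)
    (h1 : M.charpoly.roots = (Multiset.range (Fintype.card ι)).map lam)
    (h2 : K.charpoly.roots = (Multiset.range (Fintype.card ι)).map mu)
    (a d : ℝ) (hd : 0 ≤ d)
    (hq : ∀ x : ι → ℝ, x ⬝ᵥ M *ᵥ x ≤ a * (x ⬝ᵥ x) + d * (x ⬝ᵥ K *ᵥ x)) :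
    lam 1 ≤ a + d * mu 1 := by
  obtain ⟨b, hb1, hb2, hb3⟩ := spec_aux M hM lam hlam h1
  obtain ⟨w, hw1, hw2, hw3⟩ := spec_aux K hK mu hmu h2
  let i0 : Fin (Fintype.card ι) := ⟨0, by omega⟩
  let i1 : Fin (Fintype.card ι) := ⟨1, by omega⟩
  have h01 : i0 ≠ i1 := by simp [i0, i1]
  obtain ⟨s, t, hst, hs⟩ : ∃ s t : ℝ, 0 < s ^ 2 + t ^ 2 ∧
      s * (w i0 ⬝ᵥ b i0) + t * (w i0 ⬝ᵥ b i1) = 0 := by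
    by_cases h : w i0 ⬝ᵥ b i1 = 0
    · exact ⟨0, 1, by norm_num, by simp [h]⟩
    · exact ⟨w i0 ⬝ᵥ b i1, -(w i0 ⬝ᵥ b i0), by positivity, by ring⟩
  set x : ι → ℝ := s • b i0 + t • b i1 with hx
  have hwx : w i0 ⬝ᵥ x = 0 := by simp [hx, hs]
  have hxx : x ⬝ᵥ x = s ^ 2 + t ^ 2 := by
    simp [hx, hb1, h01, h01.symm]; ring
  have hxM : x ⬝ᵥ M *ᵥ x = lam 0 * s ^ 2 + lam 1 * t ^ 2 := by
    simp [hx, mulVec_add, mulVec_smul, hb2, hb1, h01, h01.symm]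
    simp [i0, i1]; ring
  have hl : lam 1 * (x ⬝ᵥ x) ≤ x ⬝ᵥ M *ᵥ x := by
    rw [hxx, hxM]
    have := hlam (show 0 ≤ 1 by omega)
    nlinarith [sq_nonneg s]
  have hr : x ⬝ᵥ K *ᵥ x ≤ mu 1 * (x ⬝ᵥ x) := by
    rw [quad_aux K hK mu w hw2 hw3, hw3 x x, Finset.mul_sum]
    refine Finset.sum_le_sum fun i _ => ?_
    by_cases hi : i = i0
    · rw [hi, hwx]; simp
    · have : mu i ≤ mu 1 := hmu (by
        rcases i with ⟨i, hi'⟩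
        simp [i0] at hi ⊢; omega)
      nlinarith [sq_nonneg (w i ⬝ᵥ x)]
  have := hq x
  have h3 : 0 < x ⬝ᵥ x := by rw [hxx]; exact hst
  have h4 : lam 1 * (x ⬝ᵥ x) ≤ (a + d * mu 1) * (x ⬝ᵥ x) := by nlinarith
  exact le_of_mul_le_mul_right h4 h3

theorem lt_one_aux {ι : Type*} [Fintype ι] [DecidableEq ι] (hc : 2 ≤ Fintype.card ι)
    (K : Matrix ι ι ℝ) (hK : K.IsHermitian)
    (mu : ℕ → ℝ) (hmu : Antitone mu) (h0 : mu 0 = 1)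
    (h2 : K.charpoly.roots = (Multiset.range (Fintype.card ι)).map mu)
    (hconst : ∀ x : ι → ℝ, K *ᵥ x = x → ∀ i j, x i = x j) : mu 1 < 1 := by
  by_contra hcon
  have hm1 : mu 1 = 1 := le_antisymm (h0 ▸ hmu (by omega)) (not_lt.1 hcon)
  obtain ⟨w, hw1, hw2, hw3⟩ := spec_aux K hK mu hmu h2
  let i0 : Fin (Fintype.card ι) := ⟨0, by omega⟩
  let i1 : Fin (Fintype.card ι) := ⟨1, by omega⟩
  have h01 : i0 ≠ i1 := by simp [i0, i1]
  have c0 := hconst (w i0) (by rw [hw2]; simp [i0, h0])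
  have c1 := hconst (w i1) (by rw [hw2]; simp [i1, hm1])
  have e0 : w i0 ⬝ᵥ w i0 = 1 := by simp [hw1]
  have e1 : w i1 ⬝ᵥ w i1 = 1 := by simp [hw1]
  have e2 : w i0 ⬝ᵥ w i1 = 0 := by simp [hw1, h01]
  have : Nonempty ι := Fintype.card_pos_iff.1 (by omega)
  let z : ι := Classical.arbitrary ι
  have k0 : w i0 = fun _ => w i0 z := funext fun i => c0 i z
  have k1 : w i1 = fun _ => w i1 z := funext fun i => c1 i z
  have f0 : w i0 ⬝ᵥ w i0 = Fintype.card ι * (w i0 z * w i0 z) := by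
    rw [k0]; simp [dotProduct]
  have f1 : w i1 ⬝ᵥ w i1 = Fintype.card ι * (w i1 z * w i1 z) := by
    rw [k1]; simp [dotProduct]
  have f2 : w i0 ⬝ᵥ w i1 = Fintype.card ι * (w i0 z * w i1 z) := by
    rw [k0, k1]; simp [dotProduct]
  rw [e0] at f0
  rw [e1] at f1
  rw [e2] at f2
  have : (1 : ℝ) * 1 = 0 * 0 := by
    nth_rewrite 1 [f0]
    nth_rewrite 1 [f1]
    rw [f2]; ring
  norm_num at this

/-- agreement outside rows i and j -/
def agreeOff {m n : ℕ} (i j : Fin m) (A B : BinMat m n) : Prop :=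
  ∀ k, k ≠ i → k ≠ j → A k = B k

theorem agreeOff_refl {m n : ℕ} (i j : Fin m) (A : BinMat m n) : agreeOff i j A A :=
  fun _ _ _ => rfl

theorem agreeOff_symm {m n : ℕ} {i j : Fin m} {A B : BinMat m n} (h : agreeOff i j A B) :
    agreeOff i j B A := fun k h1 h2 => (h k h1 h2).symm

theorem agreeOff_trans {m n : ℕ} {i j : Fin m} {A B C : BinMat m n} (h : agreeOff i j A B)
    (h' : agreeOff i j B C) : agreeOff i j A C :=
  fun k h1 h2 => (h k h1 h2).trans (h' k h1 h2)

theorem col_split {m : ℕ} (i j : Fin m) (hij : i ≠ j) (f : Fin m → Bool) :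
    (univ.filter fun k => f k = true).card =
      (f i).toNat + (f j).toNat + (univ.filter fun k => k ≠ i ∧ k ≠ j ∧ f k = true).card := by
  rw [Finset.card_filter, Finset.card_filter]
  have h1 : ∀ k, (if f k = true then 1 else 0) = (if k = i then (f i).toNat else 0)
      + (if k = j then (f j).toNat else 0) +
      (if (k ≠ i ∧ k ≠ j ∧ f k = true) then 1 else 0) := by
    intro k
    by_cases hi : k = i
    · subst hi
      cases h : f k <;> simp [hij]
    · by_cases hj : k = j
      · subst hj
        cases h : f k <;> simp [hi]
      · cases h : f k <;> simp [hi, hj]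
  rw [Finset.sum_congr rfl fun k _ => h1 k, Finset.sum_add_distrib, Finset.sum_add_distrib]
  simp

theorem agree_struct {m n : ℕ} {r : Fin m → ℕ} {c : Fin n → ℕ} {F : Finset (Fin m × Fin n)}
    {i j : Fin m} (hij : i ≠ j) {A B : BinMat m n} (hA : inOmega r c F A) (hB : inOmega r c F B)
    (h : agreeOff i j A B) (k : Fin n) :
    (A i k).toNat + (A j k).toNat = (B i k).toNat + (B j k).toNat := by
  have h1 := hA.2.1 k
  have h2 := hB.2.1 k
  rw [col_split i j hij (fun i => A i k)] at h1
  rw [col_split i j hij (fun i => B i k)] at h2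
  have h3 : (univ.filter fun l => l ≠ i ∧ l ≠ j ∧ A l k = true)
      = (univ.filter fun l => l ≠ i ∧ l ≠ j ∧ B l k = true) := by
    ext l
    simp only [mem_filter, mem_univ, true_and]
    constructor
    · rintro ⟨a, b, d⟩
      exact ⟨a, b, by rw [← h l a b]; exact d⟩
    · rintro ⟨a, b, d⟩
      exact ⟨a, b, by rw [h l a b]; exact d⟩
  rw [h3] at h1
  omega

theorem agree_mem {m n : ℕ} {r : Fin m → ℕ} {c : Fin n → ℕ} {F : Finset (Fin m × Fin n)}
    {i j : Fin m} (hij : i ≠ j) {A B : BinMat m n} (hA : inOmega r c F A) (hB : inOmega r c F B)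
    (h : agreeOff i j A B) (k : Fin n) :
    (B i k = A i k ∧ B j k = A j k) ∨
    (k ∈ Uset F i j A ∧ B i k = false ∧ B j k = true) ∨
    (k ∈ Lset F i j A ∧ B i k = true ∧ B j k = false) := by
  have h1 := agree_struct hij hA hB h k
  have h2 := fun hF => hB.2.2 (i, k) hF
  have h3 := fun hF => hB.2.2 (j, k) hF
  simp only [Uset, Lset, mem_filter, mem_univ, true_and]
  simp only at h2 h3
  revert h1 h2 h3
  cases A i k <;> cases A j k <;> cases B i k <;> cases B j k <;> simp

theorem inNbhd_iff {m n : ℕ} {r : Fin m → ℕ} {c : Fin n → ℕ} {F : Finset (Fin m × Fin n)}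
    {i j : Fin m} (hij : i ≠ j) {A B : BinMat m n} (hA : inOmega r c F A) (hB : inOmega r c F B) :
    inNbhd r c F i j A B ↔ agreeOff i j A B := by
  constructor
  · rintro ⟨_, h⟩ k h1 h2
    funext l
    exact (h k l (by simp [h1, h2])).symm
  · intro h
    refine ⟨hB, fun k l hkl => ?_⟩
    by_cases hki : k = i
    · rcases agree_mem hij hA hB h l with h' | h' | h'
      · rw [hki]; exact h'.1
      · exact absurd (by simp [hki, h'.1]) hkl
      · exact absurd (by simp [hki, h'.1]) hkl
    · by_cases hkj : k = j
      · rcases agree_mem hij hA hB h l with h' | h' | h'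
        · rw [hkj]; exact h'.2
        · exact absurd (by simp [hkj, h'.1]) hkl
        · exact absurd (by simp [hkj, h'.1]) hkl
      · exact (congrFun (h k hki hkj) l).symm

theorem UL_disj {m n : ℕ} (F : Finset (Fin m × Fin n)) (i j : Fin m) (A : BinMat m n) :
    Disjoint (Uset F i j A) (Lset F i j A) := by
  rw [Finset.disjoint_left]
  intro k hk hk'
  simp [Uset, Lset] at hk hk'
  rw [hk.1] at hk'
  simp at hk'

/-- inverse of the bijection -/
noncomputable def buildMat {m n : ℕ} (F : Finset (Fin m × Fin n)) (i j : Fin m) (A : BinMat m n)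
    (S : Finset (Fin n)) : BinMat m n := fun a k =>
  if k ∈ Uset F i j A ∪ Lset F i j A then
    (if a = i then decide (k ∈ S) else if a = j then decide (k ∉ S) else A a k)
  else A a k

theorem row_split {n : ℕ} (T : Finset (Fin n)) (f : Fin n → Bool) :
    (univ.filter fun k => f k = true).card =
      (T.filter fun k => f k = true).card + (univ.filter fun k => k ∉ T ∧ f k = true).card := by
  rw [← Finset.card_union_of_disjoint]
  · congr 1
    ext k
    simp only [mem_union, mem_filter, mem_univ, true_and]
    tauto
  · rw [Finset.disjoint_left]
    intro k
    simp only [mem_filter, mem_univ, true_and]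
    tauto

theorem U_eq {m n : ℕ} (F : Finset (Fin m × Fin n)) (i j : Fin m) (A : BinMat m n) :
    (Uset F i j A ∪ Lset F i j A).filter (fun k => A i k = true) = Uset F i j A := by
  ext k
  simp only [Uset, Lset, mem_union, mem_filter, mem_univ, true_and]
  cases A i k <;> simp

theorem L_eq {m n : ℕ} (F : Finset (Fin m × Fin n)) (i j : Fin m) (A : BinMat m n) :
    (Uset F i j A ∪ Lset F i j A).filter (fun k => A j k = true) = Lset F i j A := by
  ext k
  simp only [Uset, Lset, mem_union, mem_filter, mem_univ, true_and]
  cases A j k <;> simp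

theorem build_mem {m n : ℕ} {r : Fin m → ℕ} {c : Fin n → ℕ} {F : Finset (Fin m × Fin n)}
    {i j : Fin m} (hij : i ≠ j) {A : BinMat m n} (hA : inOmega r c F A) {S : Finset (Fin n)}
    (hS : S ⊆ Uset F i j A ∪ Lset F i j A) (hc : S.card = usize F i j A) :
    inOmega r c F (buildMat F i j A S) := by
  have hTS : (Uset F i j A ∪ Lset F i j A).card = usize F i j A + lsize F i j A :=
    Finset.card_union_of_disjoint (UL_disj F i j A)
  refine ⟨fun a => ?_, fun k => ?_, ?_⟩
  · rw [← hA.1 a]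
    rw [row_split (Uset F i j A ∪ Lset F i j A) (buildMat F i j A S a),
      row_split (Uset F i j A ∪ Lset F i j A) (A a)]
    have h1 : (univ.filter fun k => k ∉ Uset F i j A ∪ Lset F i j A ∧ buildMat F i j A S a k = true)
        = (univ.filter fun k => k ∉ Uset F i j A ∪ Lset F i j A ∧ A a k = true) := by
      refine Finset.filter_congr fun k _ => ?_
      refine and_congr_right fun hk => ?_
      unfold buildMat
      rw [if_neg hk]
    rw [h1]
    congr 1
    by_cases hai : a = i
    · subst hai
      rw [U_eq]
      have : (Uset F a j A ∪ Lset F a j A).filter (fun k => buildMat F a j A S a k = true) = S := by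
        ext k
        simp only [mem_filter]
        constructor
        · rintro ⟨h1, h2⟩
          simpa only [buildMat, if_pos h1, if_true, decide_eq_true_eq] using h2
        · intro h
          refine ⟨hS h, ?_⟩
          simpa only [buildMat, if_pos (hS h), if_true, decide_eq_true_eq] using h
      rw [this, hc]; rfl
    · by_cases haj : a = j
      · subst haj
        rw [L_eq]
        have : (Uset F i a A ∪ Lset F i a A).filter (fun k => buildMat F i a A S a k = true)
            = (Uset F i a A ∪ Lset F i a A) \ S := by
          ext k
          simp only [mem_filter, mem_sdiff]
          refine and_congr_right fun h1 => ?_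
          simp only [buildMat, if_pos h1, if_true, decide_eq_true_eq, if_neg hai]
        rw [this, Finset.card_sdiff_of_subset hS, hTS, hc]
        unfold lsize
        omega
      · congr 1
        refine Finset.filter_congr fun k hk => ?_
        simp only [buildMat, if_pos hk, if_neg hai, if_neg haj]
  · rw [← hA.2.1 k, col_split i j hij (fun a => buildMat F i j A S a k),
      col_split i j hij (fun a => A a k)]
    congr 1
    · by_cases hk : k ∈ Uset F i j A ∪ Lset F i j A
      · have : (A i k).toNat + (A j k).toNat = 1 := by
          simp only [Uset, Lset, mem_union, mem_filter, mem_univ, true_and] at hk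
          rcases hk with h | h <;> simp [h.1, h.2.1]
        rw [this]
        simp only [buildMat, if_pos hk, if_true, if_neg hij.symm]
        by_cases h : k ∈ S <;> simp [h]
      · simp only [buildMat, if_neg hk]
    · congr 1
      refine Finset.filter_congr fun a _ => ?_
      refine and_congr_right fun hai => and_congr_right fun haj => ?_
      simp only [buildMat, if_neg hai, if_neg haj, ite_self]
  · rintro ⟨a, k⟩ hF
    have h0 : A a k = false := hA.2.2 _ hF
    simp only [buildMat]
    split_ifs with h1 h2 h3
    · subst h2
      simp only [Uset, Lset, mem_union, mem_filter, mem_univ, true_and] at h1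
      simp [h0, hF] at h1
    · subst h3
      simp only [Uset, Lset, mem_union, mem_filter, mem_univ, true_and] at h1
      simp [h0, hF] at h1
    · exact h0
    · exact h0

theorem nbhd_ext {m n : ℕ} {r : Fin m → ℕ} {c : Fin n → ℕ} {F : Finset (Fin m × Fin n)}
    {i j : Fin m} (hij : i ≠ j) {A B C : BinMat m n} (hA : inOmega r c F A)
    (hB : inOmega r c F B) (hC : inOmega r c F C)
    (h : agreeOff i j A B) (h' : agreeOff i j A C) 
    (hk : ∀ k ∈ Uset F i j A ∪ Lset F i j A, B i k = C i k) : B = C := by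
  have hik : ∀ k, B i k = C i k := by
    intro k
    by_cases hT : k ∈ Uset F i j A ∪ Lset F i j A
    · exact hk k hT
    · rcases agree_mem hij hA hB h k with a | a | a
      · rcases agree_mem hij hA hC h' k with b | b | b
        · rw [a.1, b.1]
        · exact absurd (mem_union_left _ b.1) hT
        · exact absurd (mem_union_right _ b.1) hT
      · exact absurd (mem_union_left _ a.1) hT
      · exact absurd (mem_union_right _ a.1) hT
  funext a k
  by_cases hai : a = i
  · rw [hai]; exact hik k
  · by_cases haj : a = j
    · rw [haj]
      have h1 := agree_struct hij hB hC (agreeOff_trans (agreeOff_symm h) h') k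
      have h2 := hik k
      revert h1 h2
      cases B i k <;> cases B j k <;> cases C i k <;> cases C j k <;> simp
    · rw [← h a hai haj, ← h' a hai haj]

theorem nbhd_card {m n : ℕ} {r : Fin m → ℕ} {c : Fin n → ℕ} {F : Finset (Fin m × Fin n)}
    {i j : Fin m} (hij : i ≠ j) (A : OmegaType r c F) :
    (univ.filter fun B : OmegaType r c F => agreeOff i j A.val B.val).card
      = (usize F i j A.val + lsize F i j A.val).choose (usize F i j A.val) := by
  have hTS : (Uset F i j A.val ∪ Lset F i j A.val).card = usize F i j A.val + lsize F i j A.val :=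
    Finset.card_union_of_disjoint (UL_disj F i j A.val)
  rw [← hTS, ← Finset.card_powersetCard]
  refine Finset.card_bij
    (fun B _ => (Uset F i j A.val ∪ Lset F i j A.val).filter fun k => B.val i k = true) ?_ ?_ ?_
  · intro B hB
    simp only [mem_filter, mem_univ, true_and] at hB
    rw [mem_powersetCard]
    refine ⟨filter_subset _ _, ?_⟩
    have h1 := A.2.1 i
    have h2 := B.2.1 i
    rw [row_split (Uset F i j A.val ∪ Lset F i j A.val), U_eq] at h1
    rw [row_split (Uset F i j A.val ∪ Lset F i j A.val)] at h2
    have h3 : (univ.filter fun k => k ∉ Uset F i j A.val ∪ Lset F i j A.val ∧ B.val i k = true)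
        = (univ.filter fun k => k ∉ Uset F i j A.val ∪ Lset F i j A.val ∧ A.val i k = true) := by
      refine Finset.filter_congr fun k _ => ?_
      refine and_congr_right fun hT => ?_
      rcases agree_mem hij A.2 B.2 hB k with a | a | a
      · rw [a.1]
      · exact absurd (mem_union_left _ a.1) hT
      · exact absurd (mem_union_right _ a.1) hT
    rw [h3] at h2
    unfold usize
    omega
  · intro B hB C hC hBC
    simp only [mem_filter, mem_univ, true_and] at hB hC
    refine Subtype.ext (nbhd_ext hij A.2 B.2 C.2 hB hC fun k hk => ?_)
    have := Finset.ext_iff.1 hBC k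
    simp only [mem_filter, hk, true_and] at this
    exact Bool.eq_iff_iff.2 this
  · intro S hS
    rw [mem_powersetCard] at hS
    refine ⟨⟨buildMat F i j A.val S, build_mem hij A.2 hS.1 hS.2⟩, ?_, ?_⟩
    · simp only [mem_filter, mem_univ, true_and]
      intro a h1 h2
      funext k
      simp only [buildMat, if_neg h1, if_neg h2, ite_self]
    · ext k
      simp only [mem_filter]
      constructor
      · rintro ⟨h1, h2⟩
        simpa only [buildMat, if_pos h1, if_true, decide_eq_true_eq] using h2
      · intro h
        refine ⟨hS.1 h, ?_⟩
        simpa only [buildMat, if_pos (hS.1 h), if_true, decide_eq_true_eq] using h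

theorem adj_agree {m n : ℕ} {F : Finset (Fin m × Fin n)} {i j : Fin m} {A B : BinMat m n}
    (h : switchAdjIJ F i j A B) : agreeOff i j A B := by
  intro a h1 h2
  funext k
  by_contra hne
  rcases h.2.1 (a, k) (by simp [hne]) with h' | h'
  · exact h1 h'
  · exact h2 h'

theorem adj_symm {m n : ℕ} {F : Finset (Fin m × Fin n)} {i j : Fin m} {A B : BinMat m n}
    (h : switchAdjIJ F i j A B) : switchAdjIJ F i j B A := by
  unfold switchAdjIJ at h ⊢
  simp only [ne_comm (a := B _ _)]
  exact h

theorem adj_cards {m n : ℕ} {r : Fin m → ℕ} {c : Fin n → ℕ} {F : Finset (Fin m × Fin n)}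
    {i j : Fin m} (hij : i ≠ j) {A B : BinMat m n} (hA : inOmega r c F A) (hB : inOmega r c F B)
    (h : switchAdjIJ F i j A B) :
    ((Uset F i j A).filter fun k => B i k = false).card = 1 ∧
    ((Lset F i j A).filter fun k => B i k = true).card = 1 := by
  have hag := adj_agree h
  set X := (Uset F i j A).filter fun k => B i k = false with hX
  set Y := (Lset F i j A).filter fun k => B i k = true with hY
  have hXY : Disjoint X Y := Finset.disjoint_filter_filter (UL_disj F i j A)
  have h4 : (univ.filter fun p : Fin m × Fin n => A p.1 p.2 ≠ B p.1 p.2)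
      = ({i, j} : Finset (Fin m)) ×ˢ (X ∪ Y) := by
    ext ⟨a, k⟩
    simp only [mem_filter, mem_univ, true_and, mem_product, mem_insert, mem_singleton, mem_union,
      hX, hY]
    constructor
    · intro hne
      have ha := h.2.1 (a, k) (by simpa using hne)
      refine ⟨ha, ?_⟩
      rcases agree_mem hij hA hB hag k with b | b | b
      · rcases ha with rfl | rfl
        · exact absurd b.1.symm hne
        · exact absurd b.2.symm hne
      · exact Or.inl ⟨b.1, b.2.1⟩
      · exact Or.inr ⟨b.1, b.2.1⟩
    · rintro ⟨ha, hk⟩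
      have hs := agree_struct hij hA hB hag k
      simp only [Uset, Lset, mem_filter, mem_univ, true_and] at hk
      revert hs
      rcases hk with ⟨⟨b1, b2, _⟩, b3⟩ | ⟨⟨b1, b2, _⟩, b3⟩ <;> rcases ha with rfl | rfl <;>
        simp [b1, b2, b3]
      · intro e; cases h : B a k <;> simp [h] at e ⊢
  have hcard : 2 * (X.card + Y.card) = 4 := by
    have := h.1
    rw [h4, Finset.card_product, Finset.card_pair hij, Finset.card_union_of_disjoint hXY] at this
    exact this
  have h1 := hA.1 i
  have h2 := hB.1 i
  rw [row_split (X ∪ Y)] at h1 h2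
  have h3 : (univ.filter fun k => k ∉ X ∪ Y ∧ B i k = true)
        = (univ.filter fun k => k ∉ X ∪ Y ∧ A i k = true) := by
    refine Finset.filter_congr fun k _ => ?_
    refine and_congr_right fun hT => ?_
    rcases agree_mem hij hA hB hag k with a | a | a
    · rw [a.1]
    · exact absurd (mem_union_left _ (by simp [hX, a.1, a.2])) hT
    · exact absurd (mem_union_right _ (by simp [hY, a.1, a.2])) hT
  have h5 : (X ∪ Y).filter (fun k => A i k = true) = X := by
    ext k
    simp only [mem_filter, mem_univ, true_and, mem_union, hX, hY, Uset, Lset]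
    cases A i k <;> simp
  have h6 : (X ∪ Y).filter (fun k => B i k = true) = Y := by
    ext k
    simp only [mem_filter, mem_univ, true_and, mem_union, hX, hY, Uset, Lset]
    cases B i k <;> simp
  rw [h5] at h1
  rw [h3, h6] at h2
  omega

theorem adj_degree {m n : ℕ} {r : Fin m → ℕ} {c : Fin n → ℕ} {F : Finset (Fin m × Fin n)}
    {i j : Fin m} (hij : i ≠ j) (A : OmegaType r c F) :
    4 * (univ.filter fun B : OmegaType r c F => switchAdjIJ F i j A.val B.val).card ≤ n ^ 2 := by
  have hTS : (Uset F i j A.val ∪ Lset F i j A.val).card = usize F i j A.val + lsize F i j A.val :=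
    Finset.card_union_of_disjoint (UL_disj F i j A.val)
  have hn : usize F i j A.val + lsize F i j A.val ≤ n := by
    rw [← hTS]
    exact (Finset.card_le_univ _).trans (by simp)
  have h1 : (univ.filter fun B : OmegaType r c F => switchAdjIJ F i j A.val B.val).card
      ≤ (powersetCard 1 (Uset F i j A.val) ×ˢ powersetCard 1 (Lset F i j A.val)).card := by
    refine Finset.card_le_card_of_injOn (fun B => ((Uset F i j A.val).filter fun k => B.val i k = false,
      (Lset F i j A.val).filter fun k => B.val i k = true)) ?_ ?_
    · intro B hB
      have hB' : switchAdjIJ F i j A.val B.val := by simpa using hB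
      have := adj_cards hij A.2 B.2 hB'
      simp only [coe_product, Set.mem_prod, mem_coe, mem_powersetCard]
      exact ⟨⟨filter_subset _ _, this.1⟩, ⟨filter_subset _ _, this.2⟩⟩
    · intro B hB C hC hBC
      have hB' : switchAdjIJ F i j A.val B.val := by simpa using hB
      have hC' : switchAdjIJ F i j A.val C.val := by simpa using hC
      refine Subtype.ext (nbhd_ext hij A.2 B.2 C.2 (adj_agree hB') (adj_agree hC') fun k hk => ?_)
      simp only [Prod.mk.injEq] at hBC
      have e1 := Finset.ext_iff.1 hBC.1 k
      have e2 := Finset.ext_iff.1 hBC.2 k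
      simp only [mem_filter] at e1 e2
      rcases mem_union.1 hk with hk | hk
      · simp only [hk, true_and] at e1
        cases hb : B.val i k <;> cases hc : C.val i k <;> simp [hb, hc] at e1 ⊢
      · simp only [hk, true_and] at e2
        exact Bool.eq_iff_iff.2 e2
  rw [card_product, card_powersetCard, card_powersetCard, Nat.choose_one_right,
    Nat.choose_one_right] at h1
  change _ ≤ usize F i j A.val * lsize F i j A.val at h1
  zify at *
  nlinarith [sq_nonneg ((usize F i j A.val : ℤ) - lsize F i j A.val)]

theorem card_rowPairs (m : ℕ) : (rowPairs m).card = m.choose 2 := by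
  unfold rowPairs
  rw [Finset.card_filter, Fintype.sum_prod_type, Finset.sum_comm]
  have h : ∀ y : Fin m, (∑ x : Fin m, if x < y then 1 else 0) = (y : ℕ) := by
    intro y
    rw [← Finset.card_filter]
    have : (univ.filter fun x : Fin m => x < y) = Finset.Iio y := by
      ext x; simp
    rw [this, Fin.card_Iio]
  simp only [h]
  rw [Fin.sum_univ_eq_sum_range (fun i => i), Finset.sum_range_id, Nat.choose_two_right]

section analysis

variable {m n : ℕ} {r : Fin m → ℕ} {c : Fin n → ℕ} {F : Finset (Fin m × Fin n)}

/-- the class of A -/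
noncomputable def cls (p : Fin m × Fin m) (A : OmegaType r c F) : Finset (OmegaType r c F) :=
  univ.filter fun B => agreeOff p.1 p.2 A.val B.val

theorem mem_cls {p : Fin m × Fin m} {A B : OmegaType r c F} :
    B ∈ cls p A ↔ agreeOff p.1 p.2 A.val B.val := by
  simp [cls]

theorem cls_eq {p : Fin m × Fin m} {A B : OmegaType r c F}
    (h : agreeOff p.1 p.2 A.val B.val) : cls p A = cls p B := by
  ext C
  rw [mem_cls, mem_cls]
  exact ⟨fun h' => agreeOff_trans (agreeOff_symm h) h', fun h' => agreeOff_trans h h'⟩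

theorem cls_card_pos (p : Fin m × Fin m) (A : OmegaType r c F) : 0 < (cls p A).card :=
  Finset.card_pos.2 ⟨A, mem_cls.2 (agreeOff_refl _ _ _)⟩

/-- class average -/
noncomputable def avg (p : Fin m × Fin m) (x : OmegaType r c F → ℝ) (A : OmegaType r c F) : ℝ :=
  ((cls p A).card : ℝ)⁻¹ * ∑ B ∈ cls p A, x B

theorem avg_eq {p : Fin m × Fin m} {A B : OmegaType r c F} (x : OmegaType r c F → ℝ)
    (h : agreeOff p.1 p.2 A.val B.val) : avg p x A = avg p x B := by
  unfold avg
  rw [cls_eq h]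

theorem sum_avg_sq (p : Fin m × Fin m) (x : OmegaType r c F → ℝ) :
    ∑ A, avg p x A ^ 2 = ∑ A, x A * avg p x A := by
  have h1 : ∀ A : OmegaType r c F, avg p x A ^ 2 =
      ∑ B, if agreeOff p.1 p.2 A.val B.val then
        x B * (((cls p B).card : ℝ)⁻¹ * avg p x B) else 0 := by
    intro A
    rw [← Finset.sum_filter, sq]
    nth_rewrite 1 [avg]
    rw [mul_comm _ (∑ B ∈ cls p A, x B), mul_assoc, Finset.sum_mul]
    refine Finset.sum_congr rfl fun B hB => ?_
    have hB' : agreeOff p.1 p.2 A.val B.val := by simpa using hB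
    rw [cls_eq hB', avg_eq x hB']
  simp only [h1]
  rw [Finset.sum_comm]
  refine Finset.sum_congr rfl fun B _ => ?_
  rw [← Finset.sum_filter, Finset.sum_const, nsmul_eq_mul]
  have h2 : (univ.filter fun A : OmegaType r c F => agreeOff p.1 p.2 A.val B.val) = cls p B := by
    ext A
    simp only [mem_filter, mem_univ, true_and, mem_cls]
    exact ⟨agreeOff_symm, agreeOff_symm⟩
  rw [h2]
  have : ((cls p B).card : ℝ) ≠ 0 := by exact_mod_cast (cls_card_pos p B).ne'
  field_simp

theorem sum_dev_sq (p : Fin m × Fin m) (x : OmegaType r c F → ℝ) :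
    ∑ A, (x A - avg p x A) ^ 2 = ∑ A, x A ^ 2 - ∑ A, x A * avg p x A := by
  have h := sum_avg_sq p x
  have : ∀ A, (x A - avg p x A) ^ 2 = x A ^ 2 - 2 * (x A * avg p x A) + avg p x A ^ 2 := by
    intro A; ring
  simp only [this]
  rw [Finset.sum_add_distrib, Finset.sum_sub_distrib, ← Finset.mul_sum, h]
  ring

theorem Pcurve_eq (A B : OmegaType r c F) :
    Pcurve r c F A B = (m.choose 2 : ℝ)⁻¹ *
      ∑ p ∈ rowPairs m, if agreeOff p.1 p.2 A.val B.val then ((cls p A).card : ℝ)⁻¹ else 0 := by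
  have hc : ∀ p ∈ rowPairs m, (((usize F p.1 p.2 A.val + lsize F p.1 p.2 A.val).choose
            (usize F p.1 p.2 A.val) : ℕ) : ℝ) = ((cls p A).card : ℝ) := by
    intro p hp
    have : p.1 < p.2 := by simpa [rowPairs] using hp
    rw [← nbhd_card this.ne]
    rfl
  simp only [Pcurve, Matrix.of_apply]
  split_ifs with h
  · subst h
    congr 1
    refine Finset.sum_congr rfl fun p hp => ?_
    rw [if_pos (agreeOff_refl _ _ _), hc p hp]
  · rw [Finset.mul_sum]
    refine Finset.sum_congr rfl fun p hp => ?_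
    have : p.1 < p.2 := by simpa [rowPairs] using hp
    by_cases h' : agreeOff p.1 p.2 A.val B.val
    · rw [if_pos h', if_pos ((inNbhd_iff this.ne A.2 B.2).2 h'), hc p hp]
    · rw [if_neg h', if_neg (fun h'' => h' ((inNbhd_iff this.ne A.2 B.2).1 h'')), mul_zero]

theorem Pcurve_herm : (Pcurve r c F).IsHermitian := by
  ext A B
  rw [Matrix.conjTranspose_apply, star_trivial, Pcurve_eq, Pcurve_eq]
  congr 1
  refine Finset.sum_congr rfl fun p _ => ?_
  by_cases h : agreeOff p.1 p.2 A.val B.val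
  · rw [if_pos h, if_pos (agreeOff_symm h), cls_eq h]
  · rw [if_neg h, if_neg (fun h' => h (agreeOff_symm h'))]

theorem Pcurve_quad (x : OmegaType r c F → ℝ) (hm : m.choose 2 ≠ 0) :
    ∑ A, x A ^ 2 - x ⬝ᵥ (Pcurve r c F) *ᵥ x =
      (m.choose 2 : ℝ)⁻¹ * ∑ p ∈ rowPairs m, ∑ A, (x A - avg p x A) ^ 2 := by
  have h1 : ∀ A, ((Pcurve r c F) *ᵥ x) A = (m.choose 2 : ℝ)⁻¹ * ∑ p ∈ rowPairs m, avg p x A := by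
    intro A
    simp only [mulVec, dotProduct, Pcurve_eq]
    simp only [mul_assoc, Finset.sum_mul, ← Finset.mul_sum]
    rw [Finset.sum_comm]
    congr 1
    refine Finset.sum_congr rfl fun p _ => ?_
    simp only [ite_mul, zero_mul]
    rw [← Finset.sum_filter, ← Finset.mul_sum]
    rfl
  have h2 : x ⬝ᵥ (Pcurve r c F) *ᵥ x
      = (m.choose 2 : ℝ)⁻¹ * ∑ p ∈ rowPairs m, ∑ A, x A * avg p x A := by
    simp only [dotProduct, h1]
    rw [Finset.sum_comm, Finset.mul_sum]
    refine Finset.sum_congr rfl fun A _ => ?_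
    rw [Finset.mul_sum, Finset.mul_sum, Finset.mul_sum]
    refine Finset.sum_congr rfl fun A _ => ?_
    ring
  rw [h2]
  simp only [sum_dev_sq]
  rw [Finset.sum_sub_distrib, Finset.sum_const, card_rowPairs, nsmul_eq_mul]
  have : (m.choose 2 : ℝ) ≠ 0 := by exact_mod_cast hm
  field_simp

/-- global adjacency -/
def gAdj (A B : OmegaType r c F) : Prop :=
  B ≠ A ∧ ∃ p ∈ rowPairs m, switchAdjIJ F p.1 p.2 A.val B.val

theorem gAdj_symm {A B : OmegaType r c F} (h : gAdj A B) : gAdj B A := by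
  obtain ⟨h1, p, hp, h2⟩ := h
  exact ⟨h1.symm, p, hp, adj_symm h2⟩

/-- off-diagonal weights -/
noncomputable def wt (ρ : ℕ) (A B : OmegaType r c F) : ℝ :=
  if gAdj A B then ((ρ.choose 2 : ℕ) : ℝ)⁻¹ else 0

theorem wt_symm (ρ : ℕ) (A B : OmegaType r c F) : wt ρ A B = wt ρ B A := by
  unfold wt
  by_cases h : gAdj A B
  · rw [if_pos h, if_pos (gAdj_symm h)]
  · rw [if_neg h, if_neg (fun h' => h (gAdj_symm h'))]

theorem wt_nonneg (ρ : ℕ) (A B : OmegaType r c F) : 0 ≤ wt ρ A B := by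
  unfold wt
  split_ifs <;> positivity

theorem Pedge_eq (ρ : ℕ) (A B : OmegaType r c F) :
    Pedge r c F ρ A B = wt ρ A B + if A = B then (1 - ∑ C, wt ρ A C) else 0 := by
  simp only [Pedge, Matrix.of_apply]
  by_cases h : A = B
  · subst h
    rw [if_pos rfl, if_pos rfl]
    have h1 : wt ρ A A = 0 := by
      unfold wt
      rw [if_neg]
      intro h; exact h.1 rfl
    rw [h1, zero_add]
    congr 1
    rw [Finset.sum_filter]
    refine Finset.sum_congr rfl fun C _ => ?_
    unfold wt
    by_cases hC : gAdj A C
    · rw [if_pos hC]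
      exact if_pos hC
    · rw [if_neg hC]
      exact if_neg hC
  · rw [if_neg h, if_neg h, add_zero]
    unfold wt gAdj
    simp only [ne_eq, Ne.symm h, not_false_eq_true, true_and]

theorem Pedge_herm (ρ : ℕ) : (Pedge r c F ρ).IsHermitian := by
  ext A B
  rw [Matrix.conjTranspose_apply, star_trivial, Pedge_eq, Pedge_eq, wt_symm]
  congr 1
  by_cases h : A = B
  · subst h; rfl
  · rw [if_neg h, if_neg (Ne.symm h)]

theorem Pedge_quad (ρ : ℕ) (x : OmegaType r c F → ℝ) :
    2 * (∑ A, x A ^ 2 - x ⬝ᵥ (Pedge r c F ρ) *ᵥ x) = ∑ A, ∑ B, wt ρ A B * (x A - x B) ^ 2 := by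
  have h1 : ∀ A, ((Pedge r c F ρ) *ᵥ x) A = x A + ∑ B, wt ρ A B * (x B - x A) := by
    intro A
    simp only [mulVec, dotProduct, Pedge_eq, add_mul, mul_sub, Finset.sum_add_distrib,
      Finset.sum_sub_distrib, ite_mul, zero_mul, Finset.sum_ite_eq, Finset.mem_univ, if_true,
      ← Finset.sum_mul]
    ring
  have h2 : ∑ A, x A ^ 2 - x ⬝ᵥ (Pedge r c F ρ) *ᵥ x
      = ∑ A, ∑ B, wt ρ A B * (x A ^ 2 - x A * x B) := by
    simp only [dotProduct, h1]
    rw [← Finset.sum_sub_distrib]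
    refine Finset.sum_congr rfl fun A _ => ?_
    have : ∑ B, wt ρ A B * (x A ^ 2 - x A * x B) = - (x A * ∑ B, wt ρ A B * (x B - x A)) := by
      rw [Finset.mul_sum, ← Finset.sum_neg_distrib]
      refine Finset.sum_congr rfl fun B _ => ?_
      ring
    rw [this]; ring
  have h3 : ∑ A, ∑ B, wt ρ A B * (x A ^ 2 - x A * x B)
      = ∑ A, ∑ B, wt ρ A B * (x B ^ 2 - x A * x B) := by
    rw [Finset.sum_comm]
    refine Finset.sum_congr rfl fun A _ => Finset.sum_congr rfl fun B _ => ?_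
    rw [wt_symm]; ring
  rw [two_mul, h2]
  nth_rewrite 2 [h3]
  simp only [← Finset.sum_add_distrib]
  refine Finset.sum_congr rfl fun A _ => Finset.sum_congr rfl fun B _ => ?_
  ring

theorem local_bound (p : Fin m × Fin m) (hp : p ∈ rowPairs m) (x : OmegaType r c F → ℝ) :
    ∑ A : OmegaType r c F, ∑ B : OmegaType r c F,
      (if switchAdjIJ F p.1 p.2 A.val B.val then (x A - x B) ^ 2 else 0)
      ≤ (n : ℝ) ^ 2 * ∑ A, (x A - avg p x A) ^ 2 := by
  have hlt : p.1 < p.2 := by simpa [rowPairs] using hp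
  set g : OmegaType r c F → ℝ := fun A => (x A - avg p x A) ^ 2 with hg
  have h1 : ∑ A : OmegaType r c F, ∑ B : OmegaType r c F,
      (if switchAdjIJ F p.1 p.2 A.val B.val then (x A - x B) ^ 2 else 0) ≤
      ∑ A : OmegaType r c F, ∑ B : OmegaType r c F,
      ((if switchAdjIJ F p.1 p.2 A.val B.val then 2 * g A else 0) +
        (if switchAdjIJ F p.1 p.2 A.val B.val then 2 * g B else 0)) := by
    refine Finset.sum_le_sum fun A _ => Finset.sum_le_sum fun B _ => ?_
    by_cases h : switchAdjIJ F p.1 p.2 A.val B.val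
    · rw [if_pos h, if_pos h, if_pos h]
      have h2 := avg_eq x (adj_agree h)
      simp only [hg]
      rw [h2]
      nlinarith [sq_nonneg ((x A - avg p x B) + (x B - avg p x B))]
    · rw [if_neg h, if_neg h, if_neg h]; simp
  have h2 : ∑ A : OmegaType r c F, ∑ B : OmegaType r c F,
      (if switchAdjIJ F p.1 p.2 A.val B.val then 2 * g B else 0)
      = ∑ A : OmegaType r c F, ∑ B : OmegaType r c F,
      (if switchAdjIJ F p.1 p.2 A.val B.val then 2 * g A else 0) := by
    rw [Finset.sum_comm]
    refine Finset.sum_congr rfl fun A _ => Finset.sum_congr rfl fun B _ => ?_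
    by_cases h : switchAdjIJ F p.1 p.2 A.val B.val
    · rw [if_pos h, if_pos (adj_symm h)]
    · rw [if_neg h, if_neg (fun h' => h (adj_symm h'))]
  refine h1.trans ?_
  simp only [Finset.sum_add_distrib]
  rw [h2, ← Finset.sum_add_distrib, Finset.mul_sum]
  refine Finset.sum_le_sum fun A _ => ?_
  rw [← Finset.sum_filter, Finset.sum_const, nsmul_eq_mul]
  have hd : (4 : ℝ) * ((univ.filter fun B : OmegaType r c F =>
      switchAdjIJ F p.1 p.2 A.val B.val).card : ℝ) ≤ (n : ℝ) ^ 2 := by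
    exact_mod_cast adj_degree hlt.ne A
  have hgA : 0 ≤ g A := sq_nonneg _
  have := mul_le_mul_of_nonneg_right hd hgA
  change _ ≤ (n : ℝ) ^ 2 * g A
  linarith

theorem edge_bound (ρ : ℕ) (x : OmegaType r c F → ℝ) :
    2 * (∑ A, x A ^ 2 - x ⬝ᵥ (Pedge r c F ρ) *ᵥ x) ≤
      ((ρ.choose 2 : ℕ) : ℝ)⁻¹ * ((n : ℝ) ^ 2 *
        ∑ p ∈ rowPairs m, ∑ A, (x A - avg p x A) ^ 2) := by
  rw [Pedge_quad]
  have h1 : ∀ A B : OmegaType r c F, wt ρ A B * (x A - x B) ^ 2 ≤ ((ρ.choose 2 : ℕ) : ℝ)⁻¹ *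
      ∑ p ∈ rowPairs m, (if switchAdjIJ F p.1 p.2 A.val B.val then (x A - x B) ^ 2 else 0) := by
    intro A B
    have hnn : ∀ p ∈ rowPairs m,
        0 ≤ (if switchAdjIJ F p.1 p.2 A.val B.val then (x A - x B) ^ 2 else 0) := by
      intro p _
      split_ifs <;> positivity
    have hK : 0 ≤ ((ρ.choose 2 : ℕ) : ℝ)⁻¹ := by positivity
    unfold wt
    split_ifs with h
    · obtain ⟨_, p, hp, h'⟩ := h
      refine mul_le_mul_of_nonneg_left ?_ hK
      have := Finset.single_le_sum hnn hp
      rwa [if_pos h'] at this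
    · rw [zero_mul]
      exact mul_nonneg hK (Finset.sum_nonneg hnn)
  refine (Finset.sum_le_sum fun A _ => Finset.sum_le_sum fun B _ => h1 A B).trans ?_
  simp only [← Finset.mul_sum]
  refine mul_le_mul_of_nonneg_left ?_ (by positivity)
  have h2 : ∑ A : OmegaType r c F, ∑ B : OmegaType r c F, ∑ p ∈ rowPairs m,
      (if switchAdjIJ F p.1 p.2 A.val B.val then (x A - x B) ^ 2 else 0)
      = ∑ p ∈ rowPairs m, ∑ A : OmegaType r c F, ∑ B : OmegaType r c F,
      (if switchAdjIJ F p.1 p.2 A.val B.val then (x A - x B) ^ 2 else 0) := by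
    rw [Finset.sum_comm (s := rowPairs m)]
    refine Finset.sum_congr rfl fun A _ => ?_
    rw [Finset.sum_comm]
  rw [h2, Finset.mul_sum]
  exact Finset.sum_le_sum fun p hp => local_bound p hp x

theorem conn_const (ρ : ℕ)
    (hirr : ∀ A B : OmegaType r c F, ∃ t : ℕ, 0 < ((Pedge r c F ρ) ^ t) A B)
    (x : OmegaType r c F → ℝ) (hx : ∀ A B : OmegaType r c F, gAdj A B → x A = x B)
    (A B : OmegaType r c F) : x A = x B := by
  have key : ∀ t : ℕ, ∀ B : OmegaType r c F, ((Pedge r c F ρ) ^ t) A B ≠ 0 → x A = x B := by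
    intro t
    induction t with
    | zero =>
      intro B h
      by_cases hAB : A = B
      · rw [hAB]
      · rw [pow_zero, Matrix.one_apply_ne hAB] at h
        exact absurd rfl h
    | succ t ih =>
      intro B h
      rw [pow_succ, Matrix.mul_apply] at h
      obtain ⟨C, _, hC⟩ := Finset.exists_ne_zero_of_sum_ne_zero h
      rw [ih C (left_ne_zero_of_mul hC)]
      have h2 := right_ne_zero_of_mul hC
      by_cases hCB : C = B
      · rw [hCB]
      · rw [Pedge_eq, if_neg hCB, add_zero] at h2
        refine hx C B ?_
        by_contra hn
        exact h2 (by unfold wt; rw [if_neg hn])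
  obtain ⟨t, ht⟩ := hirr A B
  exact key t B ht.ne'

theorem harm_const (ρ : ℕ) (hρ : 2 ≤ ρ)
    (hirr : ∀ A B : OmegaType r c F, ∃ t : ℕ, 0 < ((Pedge r c F ρ) ^ t) A B)
    (x : OmegaType r c F → ℝ) (hx : (Pedge r c F ρ) *ᵥ x = x) 
    (A B : OmegaType r c F) : x A = x B := by
  refine conn_const ρ hirr x (fun A B hAB => ?_) A B
  have h := Pedge_quad ρ x
  have h0 : x ⬝ᵥ x = ∑ A, x A ^ 2 := by
    simp only [dotProduct, sq]
  rw [hx, h0, sub_self, mul_zero] at h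
  have hnn : ∀ A B : OmegaType r c F, 0 ≤ wt ρ A B * (x A - x B) ^ 2 :=
    fun A B => mul_nonneg (wt_nonneg ρ A B) (sq_nonneg _)
  have h1 := (Finset.sum_eq_zero_iff_of_nonneg
    (fun A _ => Finset.sum_nonneg fun B _ => hnn A B)).1 h.symm A (mem_univ _)
  have h2 := (Finset.sum_eq_zero_iff_of_nonneg (fun B _ => hnn A B)).1 h1 B (mem_univ _)
  have hK : 0 < ρ.choose 2 := Nat.choose_pos hρ
  have h3 : wt ρ A B ≠ 0 := by
    unfold wt
    rw [if_pos hAB]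
    have : ((ρ.choose 2 : ℕ) : ℝ) ≠ 0 := by exact_mod_cast hK.ne'
    exact inv_ne_zero this
  have h4 := (mul_eq_zero.1 h2).resolve_left h3
  have h5 := pow_eq_zero_iff (two_ne_zero) |>.1 h4
  linarith

end analysis

end helpers

open Matrix in
/-- with `ρ = Σᵢ rᵢ ≥ 2`, the edge-switch chain irreducible, and
`δ = 2 C(ρ,2)/(n² C(m,2)) ≤ 1`, the relaxation times satisfy
`(1 - λ_*^c)⁻¹ ≤ (1/δ)·(1 - λ_*^edge)⁻¹`, where `λ_*` denotes in each case the
second-largest eigenvalue (given by antitone enumerations of the eigenvalue multisets). -/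
theorem stmt_11 {m n : ℕ} (r : Fin m → ℕ) (c : Fin n → ℕ) (F : Finset (Fin m × Fin n))
    (ρ : ℕ) (hρdef : ρ = ∑ i, r i) (hρ : 2 ≤ ρ)
    (hcard : 2 ≤ Fintype.card (OmegaType r c F))
    (hirr : ∀ A B : OmegaType r c F, ∃ t : ℕ, 0 < ((Pedge r c F ρ) ^ t) A B)
    (δ : ℝ) (hδdef : δ = 2 * (ρ.choose 2 : ℝ) / ((n : ℝ) ^ 2 * (m.choose 2 : ℝ)))
    (hδ1 : δ ≤ 1)
    (lamC lamE : ℕ → ℝ)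
    (hCanti : Antitone lamC) (hC0 : lamC 0 = 1)
    (hCroots : (Pcurve r c F).charpoly.roots
      = (Multiset.range (Fintype.card (OmegaType r c F))).map lamC)
    (hEanti : Antitone lamE) (hE0 : lamE 0 = 1)
    (hEroots : (Pedge r c F ρ).charpoly.roots
      = (Multiset.range (Fintype.card (OmegaType r c F))).map lamE) :
    (1 - lamC 1)⁻¹ ≤ (1 / δ) * (1 - lamE 1)⁻¹ := by
  have hnt : Nontrivial (OmegaType r c F) := Fintype.one_lt_card_iff_nontrivial.1 (by omega)
  have hm : m.choose 2 ≠ 0 := by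
    intro h0
    obtain ⟨A, B, hAB⟩ := exists_pair_ne (OmegaType r c F)
    have := conn_const ρ hirr (fun C => if C = A then 1 else 0) (fun C D hCD => by
      obtain ⟨_, p, hp, _⟩ := hCD
      have : 0 < (rowPairs m).card := Finset.card_pos.2 ⟨p, hp⟩
      rw [card_rowPairs] at this
      omega) A B
    simp [hAB.symm] at this
  have hn : n ≠ 0 := by
    rintro rfl
    obtain ⟨A, B, hAB⟩ := exists_pair_ne (OmegaType r c F)
    exact hAB (Subtype.ext (funext fun i => funext fun k => k.elim0))
  have hK : 0 < ρ.choose 2 := Nat.choose_pos hρ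
  have hKr : (0 : ℝ) < (ρ.choose 2 : ℝ) := by exact_mod_cast hK
  have hmr : (0 : ℝ) < (m.choose 2 : ℝ) := by exact_mod_cast Nat.pos_of_ne_zero hm
  have hnr : (0 : ℝ) < (n : ℝ) := by exact_mod_cast Nat.pos_of_ne_zero hn
  have hδ : 0 < δ := by rw [hδdef]; positivity
  have hE1 : lamE 1 < 1 := lt_one_aux hcard _ (Pedge_herm ρ) lamE hEanti hE0 hEroots
    (fun x hx => harm_const ρ hρ hirr x hx)
  have hC1 : lamC 1 ≤ (1 - δ) + δ * lamE 1 := by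
    refine compare_aux hcard _ _ Pcurve_herm (Pedge_herm ρ) lamC lamE hCanti hEanti hCroots
      hEroots (1 - δ) δ hδ.le fun x => ?_
    have h1 := Pcurve_quad x hm
    have h2 := edge_bound ρ x
    have h0 : x ⬝ᵥ x = ∑ A, x A ^ 2 := by
      simp only [dotProduct, sq]
    rw [h0]
    set S := ∑ p ∈ rowPairs m, ∑ A, (x A - avg p x A) ^ 2 with hS
    have h3 := mul_le_mul_of_nonneg_left h2 hδ.le
    have h4 : δ * ((ρ.choose 2 : ℝ)⁻¹ * ((n : ℝ) ^ 2 * S)) = 2 * ((m.choose 2 : ℝ)⁻¹ * S) := by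
      rw [hδdef]; field_simp
    rw [h4, ← h1] at h3
    linarith
  have h5 : δ * (1 - lamE 1) ≤ 1 - lamC 1 := by linarith
  have h6 : 0 < δ * (1 - lamE 1) := mul_pos hδ (by linarith)
  calc (1 - lamC 1)⁻¹ ≤ (δ * (1 - lamE 1))⁻¹ := inv_anti₀ h6 h5
    _ = (1 / δ) * (1 - lamE 1)⁻¹ := by rw [mul_inv, one_div]
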